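/- arXiv:1105.1393 — 4 statements merged into one kernel-verified Lean document; each statement's English description precedes it below -/
import Mathlib

section
/- Let f : ℝ → ℝ be twice continuously differentiable, let M₀, M₁ ≥ 0 and δ ≥ 0 with |f''(s)| ≤ δ for all s ∈ [-M₀, M₀], and let T > 0 satisfy δ·M₁·T < 1. Let u be twice continuously differentiable on [0,T] × ℝ, with u and ∂_x u bounded on [0,T] × ℝ, satisfying ∂_t u + f'(u) ∂_x u = 0 there, and suppose |u(0,x)| ≤ M₀ and |∂_x u(0,x)| ≤ M₁ for all x ∈ ℝ. Then |u(t,x)| ≤ M₀ and |∂_x u(t,x)| ≤ M₁ / (1 − δ·M₁·t) for all (t,x) ∈ [0,T] × ℝ; in particular, if T ≤ 1/(2δM₁), then |∂_x u(t,x)| ≤ 2M₁ on [0,T] × ℝ. -/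
open Set

/-- Sup-norm preservation of a classical solution and Riccati-type control of its
first spatial derivative on a short time interval. -/
theorem sup_bound_and_derivative_bound
    (f : ℝ → ℝ) (hf : ContDiff ℝ 2 f)
    (M₀ M₁ δ : ℝ) (hM₀ : 0 ≤ M₀) (hM₁ : 0 ≤ M₁) (hδ : 0 ≤ δ)
    (hf'' : ∀ s ∈ Icc (-M₀) M₀, |iteratedDeriv 2 f s| ≤ δ)
    (T : ℝ) (hT : 0 < T) (hsmall : δ * M₁ * T < 1)
    (u : ℝ → ℝ → ℝ)
    (hu : ContDiffOn ℝ 2 (fun p : ℝ × ℝ => u p.1 p.2) (Icc 0 T ×ˢ univ))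
    (hub : ∃ C : ℝ, ∀ t ∈ Icc (0:ℝ) T, ∀ x : ℝ, |u t x| ≤ C)
    (huxb : ∃ C : ℝ, ∀ t ∈ Icc (0:ℝ) T, ∀ x : ℝ, |deriv (fun y => u t y) x| ≤ C)
    (hpde : ∀ t ∈ Icc (0:ℝ) T, ∀ x : ℝ,
      deriv (fun s => u s x) t + deriv f (u t x) * deriv (fun y => u t y) x = 0)
    (hinit0 : ∀ x : ℝ, |u 0 x| ≤ M₀)
    (hinit1 : ∀ x : ℝ, |deriv (fun y => u 0 y) x| ≤ M₁) :
    (∀ t ∈ Icc (0:ℝ) T, ∀ x : ℝ,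
        |u t x| ≤ M₀ ∧ |deriv (fun y => u t y) x| ≤ M₁ / (1 - δ * M₁ * t))
    ∧ (T ≤ 1 / (2 * δ * M₁) →
        ∀ t ∈ Icc (0:ℝ) T, ∀ x : ℝ, |deriv (fun y => u t y) x| ≤ 2 * M₁) := by
  obtain ⟨C, hC⟩ := hub
  obtain ⟨D, hD⟩ := huxb
  have hf1 : ContDiff ℝ 1 (deriv f) := by
    have h2 : ContDiff ℝ (1 + 1) f := by simpa [one_add_one_eq_two] using hf
    exact (contDiff_succ_iff_deriv.1 h2).2.2
  have hfd : Differentiable ℝ (deriv f) := hf1.differentiable one_ne_zero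
  have hit : iteratedDeriv 2 f = deriv (deriv f) := by
    rw [iteratedDeriv_succ, iteratedDeriv_one]
  obtain ⟨K, hK⟩ := (isCompact_Icc (a := -C) (b := C)).exists_bound_of_continuousOn
    (hf1.continuous_deriv le_rfl).continuousOn
  have hlip : ∀ a ∈ Icc (-C) C, ∀ b ∈ Icc (-C) C, |deriv f b - deriv f a| ≤ K * |b - a| := by
    intro a ha b hb
    exact (convex_Icc (-C) C).norm_image_sub_le_of_norm_deriv_le
      (fun x _ => hfd x) hK ha hb
  have hcont : ContinuousOn (fun p : ℝ × ℝ => u p.1 p.2) (Icc 0 T ×ˢ univ) := hu.continuousOn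
  have hux : ∀ t ∈ Icc (0:ℝ) T, ∀ x, DifferentiableAt ℝ (fun y => u t y) x := by
    intro t ht x
    have h1 := (hu.differentiableOn two_ne_zero) (t, x) ⟨ht, mem_univ _⟩
    have h2 : DifferentiableWithinAt ℝ (fun y : ℝ => (t, y)) univ x := by fun_prop
    have h3 := DifferentiableWithinAt.comp x (t := Icc 0 T ×ˢ univ) h1 h2
      (fun y _ => ⟨ht, mem_univ _⟩)
    exact differentiableWithinAt_univ.1 h3
  -- constancy along the straight line
  have key : ∀ t₀ ∈ Icc (0:ℝ) T, ∀ x, u 0 (x - deriv f (u t₀ x) * t₀) = u t₀ x := by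
    intro t₀ ht₀ x
    set c := deriv f (u t₀ x) with hc
    set w : ℝ → ℝ := fun t => u t (x - c * (t₀ - t)) - u t₀ x with hw
    have hmem : ∀ t ∈ Icc (0:ℝ) T, ∀ y, u t y ∈ Icc (-C) C := fun t ht y => abs_le.1 (hC t ht y)
    have hD0 : 0 ≤ D := (abs_nonneg _).trans (hD t₀ ht₀ x)
    have hwc : ContinuousOn w (Icc 0 t₀) := by
      refine ContinuousOn.sub ?_ continuousOn_const
      refine hcont.comp (f := fun t : ℝ => (t, x - c * (t₀ - t))) (by fun_prop) ?_
      intro t ht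
      exact ⟨⟨ht.1, ht.2.trans ht₀.2⟩, mem_univ _⟩
    have hwd : ∀ t ∈ Ioo 0 t₀, ∃ w', HasDerivAt w w' t ∧ |w'| ≤ D * K * |w t| := by
      intro t ht
      have htT : t ∈ Icc (0:ℝ) T := ⟨ht.1.le, ht.2.le.trans ht₀.2⟩
      set y := x - c * (t₀ - t) with hy
      have hn : Icc (0:ℝ) T ×ˢ (univ : Set ℝ) ∈ nhds (t, y) :=
        prod_mem_nhds (Icc_mem_nhds ht.1 (ht.2.trans_le ht₀.2)) Filter.univ_mem
      have hF := ((hu.contDiffAt hn).differentiableAt two_ne_zero).hasFDerivAt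
      set L := fderiv ℝ (fun p : ℝ × ℝ => u p.1 p.2) (t, y) with hL
      have e1 : HasDerivAt (fun s => u s y) (L (1, 0)) t :=
        hF.comp_hasDerivAt (f := fun s : ℝ => (s, y)) t
          ((hasDerivAt_id t).prodMk (hasDerivAt_const t y))
      have e2 : HasDerivAt (fun z => u t z) (L (0, 1)) y :=
        hF.comp_hasDerivAt (f := fun z : ℝ => (t, z)) y
          ((hasDerivAt_const y t).prodMk (hasDerivAt_id y))
      have hg : HasDerivAt (fun s : ℝ => x - c * (t₀ - s)) c t := by
        have := (((hasDerivAt_id t).const_sub t₀).const_mul c).const_sub x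
        simpa using this
      have e3 : HasDerivAt (fun s => u s (x - c * (t₀ - s))) (L (1, c)) t :=
        hF.comp_hasDerivAt (f := fun s : ℝ => (s, x - c * (t₀ - s))) t
          ((hasDerivAt_id t).prodMk hg)
      refine ⟨L (1, c), e3.sub_const _, ?_⟩
      have hp := hpde t htT y
      have hd := hD t htT y
      rw [e1.deriv, e2.deriv] at hp
      rw [e2.deriv] at hd
      have hlin : L (1, c) = L (1, 0) + c * L (0, 1) := by
        have : ((1:ℝ), c) = (1, 0) + c • ((0:ℝ), (1:ℝ)) := by simp
        rw [this, map_add, map_smul, smul_eq_mul]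
      have heq : L (1, c) = - (L (0, 1) * (deriv f (u t y) - c)) := by
        rw [hlin]; linarith
      rw [heq, abs_neg, abs_mul, mul_assoc]
      exact mul_le_mul hd (hlip _ (hmem t₀ ht₀ x) _ (hmem t htT y)) (abs_nonneg _) hD0
    have hmono : MonotoneOn (fun t => w t ^ 2 * Real.exp (2 * (D * K) * t)) (Icc 0 t₀) := by
      have hder : ∀ t ∈ Ioo 0 t₀, ∃ g', HasDerivAt
          (fun t => w t ^ 2 * Real.exp (2 * (D * K) * t)) g' t ∧ 0 ≤ g' := by
        intro t ht
        obtain ⟨w', h1, h2⟩ := hwd t ht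
        have h3 : HasDerivAt (fun t => Real.exp (2 * (D * K) * t))
            (Real.exp (2 * (D * K) * t) * (2 * (D * K))) t := by
          have := ((hasDerivAt_id t).const_mul (2 * (D * K))).exp
          simpa using this
        refine ⟨_, (h1.pow 2).mul h3, ?_⟩
        have h4 : -(D * K * (w t) ^ 2) ≤ w t * w' := by
          have : |w t * w'| ≤ D * K * (w t) ^ 2 := by
            rw [abs_mul, ← sq_abs (w t)]
            nlinarith [abs_nonneg (w t)]
          exact (abs_le.1 this).1
        have h5 := Real.exp_pos (2 * (D * K) * t)
        have h6 : 0 ≤ (2 * (w t * w') + 2 * (D * K) * (w t) ^ 2) * Real.exp (2 * (D * K) * t) :=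
          mul_nonneg (by linarith) h5.le
        refine h6.trans_eq ?_
        simp
        ring
      refine monotoneOn_of_deriv_nonneg (convex_Icc _ _) ?_ ?_ ?_
      · exact (hwc.pow 2).mul (by fun_prop)
      · intro t ht
        rw [interior_Icc] at ht
        obtain ⟨g', h, _⟩ := hder t ht
        exact h.differentiableAt.differentiableWithinAt
      · intro t ht
        rw [interior_Icc] at ht
        obtain ⟨g', h, h'⟩ := hder t ht
        rwa [h.deriv]
    have h0 := hmono (left_mem_Icc.2 ht₀.1) (right_mem_Icc.2 ht₀.1) ht₀.1
    have hw0 : w 0 ^ 2 ≤ 0 := by simpa [hw] using h0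
    have : w 0 = 0 := by nlinarith [sq_nonneg (w 0)]
    simpa [hw, sub_eq_zero] using this
  have hu0 : ∀ t ∈ Icc (0:ℝ) T, ∀ x, |u t x| ≤ M₀ := by
    intro t ht x
    rw [← key t ht x]
    exact hinit0 _
  have hpos : ∀ t ∈ Icc (0:ℝ) T, 0 < 1 - δ * M₁ * t := by
    intro t ht
    have := mul_le_mul_of_nonneg_left ht.2 (mul_nonneg hδ hM₁)
    linarith
  have main : ∀ t ∈ Icc (0:ℝ) T, ∀ x : ℝ,
      |deriv (fun y => u t y) x| ≤ M₁ / (1 - δ * M₁ * t) := by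
    intro t ht x
    set p := deriv (fun y => u t y) x with hp
    have h1 : HasDerivAt (fun y => u t y) p x := (hux t ht x).hasDerivAt
    have h2 : HasDerivAt (fun y => y - deriv f (u t y) * t)
        (1 - deriv (deriv f) (u t x) * p * t) x :=
      (hasDerivAt_id x).sub
        (((hfd (u t x)).hasDerivAt.comp x h1).mul_const t)
    have h3 := (hux 0 ⟨le_rfl, hT.le⟩ (x - deriv f (u t x) * t)).hasDerivAt.comp x h2
    have h4 : ((fun y => u 0 y) ∘ fun y => y - deriv f (u t y) * t) = fun y => u t y := by
      funext y
      exact key t ht y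
    rw [h4] at h3
    have h5 := h1.unique h3
    have hq := hinit1 (x - deriv f (u t x) * t)
    set q := deriv (fun y => u 0 y) (x - deriv f (u t x) * t)
    have hs := hf'' (u t x) (abs_le.1 (hu0 t ht x))
    rw [hit] at hs
    have h6 : |1 - deriv (deriv f) (u t x) * p * t| ≤ 1 + δ * |p| * t := by
      refine (abs_sub _ _).trans ?_
      rw [abs_one, abs_mul, abs_mul, abs_of_nonneg ht.1]
      have := mul_le_mul_of_nonneg_right
        (mul_le_mul_of_nonneg_right hs (abs_nonneg p)) ht.1
      linarith
    have h7 : |p| ≤ M₁ * (1 + δ * |p| * t) := by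
      calc |p| = |q| * |1 - deriv (deriv f) (u t x) * p * t| := by rw [← abs_mul, ← h5]
        _ ≤ _ := mul_le_mul hq h6 (abs_nonneg _) hM₁
    rw [le_div_iff₀ (hpos t ht)]
    linarith
  refine ⟨fun t ht x => ⟨hu0 t ht x, main t ht x⟩, ?_⟩
  intro hT2 t ht x
  refine (main t ht x).trans ?_
  rw [div_le_iff₀ (hpos t ht)]
  have h0 : 0 < 2 * δ * M₁ := by
    by_contra h
    have := div_nonpos_of_nonneg_of_nonpos zero_le_one (not_lt.1 h)
    linarith
  rw [le_div_iff₀ h0] at hT2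
  have h1 := mul_le_mul_of_nonneg_right ht.2 h0.le
  have h2 : δ * M₁ * t ≤ 1 / 2 := by linarith
  nlinarith
end

section
/- Let y : [0,T] → ℝ be differentiable and c : [0,T] → ℝ satisfy y'(t) = −c(t) · y(t)² and |c(t)| ≤ δ for all t ∈ [0,T], where δ ≥ 0. Suppose |y(0)| ≤ M and δ·M·T < 1. Then |y(t)| ≤ M / (1 − δ·M·t) for all t ∈ [0,T]; in particular, y does not blow up on [0,T]. -/
open Set

lemma riccati_aux
    (T δ M d m : ℝ) (hd : δ < d) (hd0 : 0 < d) (hm : M < m) (hm0 : 0 < m)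
    (y c : ℝ → ℝ)
    (hy : ∀ t ∈ Icc (0:ℝ) T, HasDerivAt y (-(c t) * (y t) ^ 2) t)
    (hc : ∀ t ∈ Icc (0:ℝ) T, |c t| ≤ δ)
    (hy0 : |y 0| ≤ M) (hsmall : d * m * T < 1) :
    ∀ t ∈ Icc (0:ℝ) T, |y t| ≤ m / (1 - d * m * t) := by
  have hpos : ∀ t ∈ Icc (0:ℝ) T, 0 < 1 - d * m * t := by
    intro t ht
    have : d * m * t ≤ d * m * T := mul_le_mul_of_nonneg_left ht.2 (by positivity)
    linarith
  have hB : ∀ t ∈ Icc (0:ℝ) T, HasDerivAt (fun t => m / (1 - d * m * t))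
      (d * (m / (1 - d * m * t)) ^ 2) t := by
    intro t ht
    have hp := (hpos t ht).ne'
    have h1 : HasDerivAt (fun t => 1 - d * m * t) (-(d * m * 1)) t :=
      ((hasDerivAt_id t).const_mul (d * m)).const_sub 1
    have h2 := (hasDerivAt_const t m).div h1 hp
    refine h2.congr_deriv ?_
    rw [div_pow]
    ring
  intro t ht
  have key := image_norm_le_of_norm_deriv_right_lt_deriv_boundary'
    (f := y) (f' := fun t => -(c t) * (y t) ^ 2) (a := 0) (b := T)
    (B := fun t => m / (1 - d * m * t)) (B' := fun t => d * (m / (1 - d * m * t)) ^ 2)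
    (fun x hx => (hy x hx).continuousAt.continuousWithinAt)
    (fun x hx => (hy x (Ico_subset_Icc_self hx)).hasDerivWithinAt)
    (by simp only [Real.norm_eq_abs, mul_zero, sub_zero, div_one]; linarith)
    (fun x hx => (hB x hx).continuousAt.continuousWithinAt)
    (fun x hx => (hB x (Ico_subset_Icc_self hx)).hasDerivWithinAt)
    (by
      intro x hx hxe
      have hx' := Ico_subset_Icc_self hx
      have hb : 0 < m / (1 - d * m * x) := div_pos hm0 (hpos x hx')
      rw [norm_mul, norm_neg, norm_pow, hxe, Real.norm_eq_abs]
      exact mul_lt_mul_of_pos_right ((hc x hx').trans_lt hd) (by positivity))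
  exact key ht

/-- No blow-up for the scalar Riccati equation `y' = -c(t) y²` with `|c| ≤ δ`,
on a time interval short enough that `δ·M·T < 1`. -/
theorem riccati_no_blowup
    (T δ M : ℝ) (hδ : 0 ≤ δ)
    (y c : ℝ → ℝ)
    (hy : ∀ t ∈ Icc (0:ℝ) T, HasDerivAt y (-(c t) * (y t) ^ 2) t)
    (hc : ∀ t ∈ Icc (0:ℝ) T, |c t| ≤ δ)
    (hy0 : |y 0| ≤ M) (hsmall : δ * M * T < 1) :
    ∀ t ∈ Icc (0:ℝ) T, |y t| ≤ M / (1 - δ * M * t) := by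
  intro t ht
  have hM : 0 ≤ M := (abs_nonneg _).trans hy0
  have hp : 0 < 1 - δ * M * t := by
    have : δ * M * t ≤ δ * M * T := mul_le_mul_of_nonneg_left ht.2 (by positivity)
    linarith
  have hcont : ContinuousAt (fun e : ℝ => (M + e) / (1 - (δ + e) * (M + e) * t)) 0 := by
    apply ContinuousAt.div
    · fun_prop
    · fun_prop
    · simpa using hp.ne'
  have hlim : Filter.Tendsto (fun e : ℝ => (M + e) / (1 - (δ + e) * (M + e) * t))
      (nhdsWithin 0 (Ioi 0)) (nhds (M / (1 - δ * M * t))) := by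
    have := hcont.tendsto.mono_left (nhdsWithin_le_nhds (s := Ioi (0:ℝ)))
    simpa using this
  have hc2 : ContinuousAt (fun e : ℝ => (δ + e) * (M + e) * T) 0 := by fun_prop
  have hev : ∀ᶠ e : ℝ in nhdsWithin 0 (Ioi 0), (δ + e) * (M + e) * T < 1 :=
    (hc2.eventually_lt_const (by simpa using hsmall)).filter_mono nhdsWithin_le_nhds
  refine ge_of_tendsto hlim ?_
  filter_upwards [hev, self_mem_nhdsWithin] with e he he0
  have he0 : 0 < e := he0
  exact riccati_aux T δ M (δ + e) (M + e) (by linarith) (by linarith) (by linarith)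
    (by linarith) y c hy hc hy0 he t ht
end

section
/- Let p be a natural number, h > 0, a ∈ ℝ, I = [a, a+h], N ≥ 0, and let g : ℝ → ℝ be (p+1)-times continuously differentiable on I with |g^{(p+1)}(x)| ≤ N for all x ∈ I. Suppose r is a polynomial of degree at most p such that g − r is L²(I)-orthogonal to every polynomial of degree at most p, i.e., ∫_I (g(x) − r(x)) · φ(x) dx = 0 for every polynomial φ of degree at most p. Then ( ∫_I (g(x) − r(x))² dx )^{1/2} ≤ N · h^{p+1} · √h / (p+1)!, and ∫_I |g(x) − r(x)| dx ≤ N · h^{p+2} / (p+1)!. -/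
open Set

theorem taylor_poly_aux
    (p : ℕ) (h a N : ℝ) (hh : 0 < h) (hN : 0 ≤ N)
    (g : ℝ → ℝ) (hg : ContDiffOn ℝ (p + 1 : ℕ) g (Icc a (a + h)))
    (hgb : ∀ x ∈ Icc a (a + h),
      |iteratedDerivWithin (p + 1) g (Icc a (a + h)) x| ≤ N) :
    ∃ T : Polynomial ℝ, T.degree ≤ (p : WithBot ℕ) ∧ ∀ x ∈ Icc a (a + h),
      |g x - T.eval x| ≤ N * h ^ (p + 1) / (Nat.factorial (p + 1)) := by
  have key : ∀ x ∈ Icc a (a + h), ∀ y, y < x → ∀ k, 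
      iteratedDerivWithin k g (Icc a x) y = iteratedDerivWithin k g (Icc a (a + h)) y := by
    intro x hx y hy k
    rw [iteratedDerivWithin_eq_iteratedFDerivWithin, iteratedDerivWithin_eq_iteratedFDerivWithin,
      iteratedFDerivWithin_congr_set]
    filter_upwards [Iio_mem_nhds hy] with z hz
    have hz' : z < x := hz
    apply propext
    change (a ≤ z ∧ z ≤ x) ↔ (a ≤ z ∧ z ≤ a + h)
    have := hx.2
    constructor <;> rintro ⟨h1, h2⟩ <;> exact ⟨h1, by linarith⟩
  refine ⟨∑ k ∈ Finset.range (p + 1), Polynomial.C (((Nat.factorial k : ℝ))⁻¹ *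
    iteratedDerivWithin k g (Icc a (a + h)) a) * (Polynomial.X - Polynomial.C a) ^ k, ?_, ?_⟩
  · refine (Polynomial.degree_sum_le _ _).trans (Finset.sup_le fun k hk => ?_)
    refine ((Polynomial.degree_mul_le _ _).trans (add_le_add_left Polynomial.degree_C_le _)).trans ?_
    rw [Polynomial.degree_pow, Polynomial.degree_X_sub_C]
    simp only [nsmul_eq_mul, mul_one, zero_add]
    exact_mod_cast Nat.lt_succ_iff.mp (Finset.mem_range.mp hk)
  · intro x hx
    rw [Polynomial.eval_finsetSum]
    simp only [Polynomial.eval_mul, Polynomial.eval_C, Polynomial.eval_pow, Polynomial.eval_sub,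
      Polynomial.eval_X]
    rcases hx.1.eq_or_lt with rfl | hax
    · rw [Finset.sum_range_succ']
      simp
      positivity
    · have hsub : Icc a x ⊆ Icc a (a + h) := Icc_subset_Icc_right hx.2
      have hg' : ContDiffOn ℝ (p + 1 : ℕ) g (Icc a x) := hg.mono hsub
      have hu : uIcc a x = Icc a x := uIcc_of_le hax.le
      have hd : DifferentiableOn ℝ (iteratedDerivWithin p g (Icc a x)) (Icc a x) :=
        hg'.differentiableOn_iteratedDerivWithin (mod_cast p.lt_succ_self) (uniqueDiffOn_Icc hax)
      obtain ⟨y, hy, e⟩ := taylor_mean_remainder_lagrange (f := g) (n := p) hax.ne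
        (by rw [hu]; exact hg'.of_le (mod_cast p.le_succ))
        (by rw [hu, uIoo_of_le hax.le]; exact hd.mono Ioo_subset_Icc_self)
      rw [uIoo_of_le hax.le] at hy
      rw [hu, taylor_within_apply, key x hx y hy.2] at e
      have : ∑ k ∈ Finset.range (p + 1), ((Nat.factorial k : ℝ))⁻¹ *
          iteratedDerivWithin k g (Icc a (a + h)) a * (x - a) ^ k =
          ∑ k ∈ Finset.range (p + 1), (((Nat.factorial k : ℝ))⁻¹ * (x - a) ^ k) •
          iteratedDerivWithin k g (Icc a x) a := by
        refine Finset.sum_congr rfl fun k _ => ?_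
        rw [key x hx a hax, smul_eq_mul]; ring
      rw [this, e, abs_div, abs_mul, Nat.abs_cast, abs_of_nonneg (pow_nonneg (sub_nonneg.2 hax.le) _)]
      have h1 := hgb y (hsub (Ioo_subset_Icc_self hy))
      have h2 : (x - a) ^ (p + 1) ≤ h ^ (p + 1) :=
        pow_le_pow_left₀ (sub_nonneg.2 hax.le) (by linarith [hx.2]) _
      have h3 := pow_nonneg (sub_nonneg.2 hax.le) (p + 1)
      gcongr

/-- Bramble–Hilbert type scaling estimate for the L²-orthogonal projection onto
polynomials of degree at most `p` on a cell `I = [a, a+h]`: if `|g^{(p+1)}| ≤ N`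
on `I`, then the L² projection error is at most `N h^{p+1} √h / (p+1)!` and the
L¹ projection error is at most `N h^{p+2} / (p+1)!`. -/
theorem projection_error_bound
    (p : ℕ) (h a N : ℝ) (hh : 0 < h) (hN : 0 ≤ N)
    (g : ℝ → ℝ) (hg : ContDiffOn ℝ (p + 1 : ℕ) g (Icc a (a + h)))
    (hgb : ∀ x ∈ Icc a (a + h),
      |iteratedDerivWithin (p + 1) g (Icc a (a + h)) x| ≤ N)
    (r : Polynomial ℝ) (hr : r.degree ≤ (p : WithBot ℕ))
    (horth : ∀ φ : Polynomial ℝ, φ.degree ≤ (p : WithBot ℕ) →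
      ∫ x in a..(a + h), (g x - r.eval x) * φ.eval x = 0) :
    Real.sqrt (∫ x in a..(a + h), (g x - r.eval x) ^ 2)
        ≤ N * h ^ (p + 1) * Real.sqrt h / (Nat.factorial (p + 1))
    ∧ (∫ x in a..(a + h), |g x - r.eval x|)
        ≤ N * h ^ (p + 2) / (Nat.factorial (p + 1)) := by
  obtain ⟨T, hT, hb⟩ := taylor_poly_aux p h a N hh hN g hg hgb
  have hM : 0 ≤ N * h ^ (p + 1) / (Nat.factorial (p + 1)) := by positivity
  have e1 : N * h ^ (p + 1) * Real.sqrt h / (Nat.factorial (p + 1)) =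
    N * h ^ (p + 1) / (Nat.factorial (p + 1)) * Real.sqrt h := by ring
  have e2 : N * h ^ (p + 2) / (Nat.factorial (p + 1)) =
    N * h ^ (p + 1) / (Nat.factorial (p + 1)) * h := by ring
  rw [e1, e2]
  generalize N * h ^ (p + 1) / (Nat.factorial (p + 1) : ℝ) = M at *
  have hle : a ≤ a + h := by linarith
  have hgc : ContinuousOn g (uIcc a (a + h)) := by rw [uIcc_of_le hle]; exact hg.continuousOn
  have hrc : ∀ q : Polynomial ℝ, ContinuousOn (fun x => q.eval x) (uIcc a (a + h)) :=
    fun q => q.continuous.continuousOn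
  have hec := hgc.sub (hrc r)
  have hfc := hgc.sub (hrc T)
  have ho := horth (r - T) ((Polynomial.degree_sub_le _ _).trans (max_le hr hT))
  have hsq : ∫ x in a..(a + h), (g x - r.eval x) ^ 2 ≤ M ^ 2 * h := by
    have i1 : IntervalIntegrable (fun x => (g x - r.eval x) ^ 2) MeasureTheory.volume a (a + h) :=
      (hec.pow 2).intervalIntegrable
    have i2 : IntervalIntegrable (fun x => (g x - r.eval x) * (r - T).eval x)
        MeasureTheory.volume a (a + h) := (hec.mul (hrc _)).intervalIntegrable
    have : ∫ x in a..(a + h), ((g x - r.eval x) ^ 2 + 2 * ((g x - r.eval x) * (r - T).eval x)) ≤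
        ∫ x in a..(a + h), M ^ 2 := by
      refine intervalIntegral.integral_mono_on hle (i1.add (i2.const_mul 2)) (by simp) ?_
      intro x hx
      have := hb x hx
      have h4 : (g x - T.eval x) ^ 2 ≤ M ^ 2 := sq_le_sq' (by linarith [(abs_le.1 this).1]) (abs_le.1 this).2
      rw [Polynomial.eval_sub]
      nlinarith [sq_nonneg (r.eval x - T.eval x)]
    rw [intervalIntegral.integral_add i1 (i2.const_mul 2), intervalIntegral.integral_const_mul, ho] at this
    simp at this
    linarith
  constructor
  · rw [show M * Real.sqrt h = Real.sqrt (M ^ 2 * h) by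
      rw [Real.sqrt_mul (sq_nonneg M), Real.sqrt_sq hM]]
    exact Real.sqrt_le_sqrt hsq
  · have i1 : IntervalIntegrable (fun x => (g x - r.eval x) ^ 2) MeasureTheory.volume a (a + h) :=
      (hec.pow 2).intervalIntegrable
    have i3 : IntervalIntegrable (fun x => |g x - r.eval x|) MeasureTheory.volume a (a + h) :=
      hec.abs.intervalIntegrable
    have hc : (2 * ((∫ x in a..(a + h), |g x - r.eval x|) / h)) *
        (∫ x in a..(a + h), |g x - r.eval x|) ≤
        (∫ x in a..(a + h), (g x - r.eval x) ^ 2) +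
          ((∫ x in a..(a + h), |g x - r.eval x|) / h) ^ 2 * h := by
      generalize (∫ x in a..(a + h), |g x - r.eval x|) / h = c
      have : ∫ x in a..(a + h), (2 * c) * |g x - r.eval x| ≤
          ∫ x in a..(a + h), ((g x - r.eval x) ^ 2 + c ^ 2) := by
        refine intervalIntegral.integral_mono_on hle (i3.const_mul _) (i1.add (by simp)) ?_
        intro x hx
        nlinarith [sq_nonneg (|g x - r.eval x| - c), sq_abs (g x - r.eval x)]
      rw [intervalIntegral.integral_add i1 (by simp), intervalIntegral.integral_const_mul] at this
      simp at this
      linarith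
    generalize (∫ x in a..(a + h), |g x - r.eval x|) = A at *
    have h5 : A ^ 2 / h ≤ M ^ 2 * h := by
      have e3 : (A / h) ^ 2 * h = A ^ 2 / h := by field_simp
      have e4 : 2 * (A / h) * A = 2 * (A ^ 2 / h) := by ring
      rw [e3, e4] at hc
      linarith
    rw [div_le_iff₀ hh] at h5
    exact abs_le_of_sq_le_sq' (by linarith [mul_pow M h 2]) (by positivity) |>.2
end

section
/- Let f : ℝ → ℝ be twice continuously differentiable, τ > 0, β ≥ 0, U > 0, with 0 ≤ f'(s) ≤ β for all s ∈ [-U, U]. Let u and v be continuously differentiable on [0,τ] × ℝ, bounded in absolute value by U together with bounded spatial derivatives, and both satisfy the conservation law ∂_t w + f'(w) ∂_x w = 0 on [0,τ] × ℝ. If u(0,x) = v(0,x) for all x ∈ [c − βτ, d], where c ≤ d, then u(t,x) = v(t,x) for all t ∈ [0,τ] and x ∈ [c, d]; that is, classical solutions of the scalar conservation law with wave speed between 0 and β depend on the initial data only within the upwind interval of width βτ. -/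
open Set

lemma char_const
    (f : ℝ → ℝ) (hf : ContDiff ℝ 2 f) (τ U : ℝ)
    (w : ℝ → ℝ → ℝ)
    (hw : ContDiffOn ℝ 1 (fun p : ℝ × ℝ => w p.1 p.2) (Icc 0 τ ×ˢ univ))
    (hwb : ∀ t ∈ Icc (0:ℝ) τ, ∀ x : ℝ, |w t x| ≤ U)
    (hwxb : ∃ C : ℝ, ∀ t ∈ Icc (0:ℝ) τ, ∀ x : ℝ, |deriv (fun y => w t y) x| ≤ C)
    (hpde : ∀ t ∈ Icc (0:ℝ) τ, ∀ x : ℝ,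
      deriv (fun s => w s x) t + deriv f (w t x) * deriv (fun y => w t y) x = 0)
    (k y : ℝ) (hk : |k| ≤ U) (s₀ : ℝ) (hs₀ : s₀ ∈ Icc (0:ℝ) τ)
    (h0 : w s₀ (y + deriv f k * s₀) = k) :
    ∀ s ∈ Icc (0:ℝ) τ, w s (y + deriv f k * s) = k := by
  obtain ⟨C, hC⟩ := hwxb
  have hf1 : ContDiff ℝ 1 (deriv f) := by
    have : ContDiff ℝ (1 + 1) f := by simpa [one_add_one_eq_two] using hf
    exact (contDiff_succ_iff_deriv.1 this).2.2
  have hL : ∃ L : ℝ, ∀ a ∈ Icc (-U) U, ∀ b ∈ Icc (-U) U,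
      |deriv f b - deriv f a| ≤ L * |b - a| := by
    obtain ⟨L, hL⟩ := (isCompact_Icc (a := -U) (b := U)).exists_bound_of_continuousOn
      (hf1.continuous_deriv le_rfl).continuousOn
    refine ⟨L, fun a ha b hb => ?_⟩
    exact (convex_Icc (-U) U).norm_image_sub_le_of_norm_deriv_le
      (fun x _ => (hf1.differentiable one_ne_zero) x) hL ha hb
  obtain ⟨L, hL⟩ := hL
  set a := deriv f k with ha
  set g : ℝ → ℝ := fun s => w s (y + a * s) - k with hg
  have hgc : ContinuousOn g (Icc 0 τ) := by
    have h1 : ContinuousOn (fun s : ℝ => ((s, y + a * s) : ℝ × ℝ)) (Icc 0 τ) := by fun_prop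
    have h2 := hw.continuousOn.comp h1 (fun s hs => ⟨hs, mem_univ _⟩)
    exact h2.sub continuousOn_const
  have hgd : ∀ s ∈ Ioo (0:ℝ) τ, ∃ g', HasDerivAt g g' s ∧ |g'| ≤ (L * C) * |g s| := by
    intro s hs
    have hs' := Ioo_subset_Icc_self hs
    set x := y + a * s with hx
    have hF : DifferentiableAt ℝ (fun p : ℝ × ℝ => w p.1 p.2) (s, x) :=
      (hw.differentiableOn one_ne_zero).differentiableAt
        (prod_mem_nhds (Icc_mem_nhds hs.1 hs.2) Filter.univ_mem)
    obtain ⟨F', hF⟩ := hF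
    have ht : HasDerivAt (fun s => w s x) (F' (1, 0)) s :=
      hF.comp_hasDerivAt (f := fun s : ℝ => ((s, x) : ℝ × ℝ)) s
        ((hasDerivAt_id s).prodMk (hasDerivAt_const s x))
    have hxx : HasDerivAt (fun x => w s x) (F' (0, 1)) x :=
      hF.comp_hasDerivAt (f := fun x : ℝ => ((s, x) : ℝ × ℝ)) x
        ((hasDerivAt_const x s).prodMk (hasDerivAt_id x))
    have hlin : HasDerivAt (fun s : ℝ => y + a * s) a s := by
      simpa using ((hasDerivAt_id s).const_mul a).const_add y
    have hgg : HasDerivAt g (F' (1, a)) s :=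
      (hF.comp_hasDerivAt (f := fun s : ℝ => ((s, y + a * s) : ℝ × ℝ)) s
        ((hasDerivAt_id s).prodMk hlin)).sub_const k
    refine ⟨_, hgg, ?_⟩
    have hsplit : F' (1, a) = F' (1, 0) + a * F' (0, 1) := by
      have : ((1, a) : ℝ × ℝ) = (1, 0) + a • (0, 1) := by simp
      rw [this, map_add, map_smul, smul_eq_mul]
    have hp := hpde s hs' x
    have hc := hC s hs' x
    rw [hxx.deriv] at hc
    rw [ht.deriv, hxx.deriv] at hp
    have hl := hL (w s x) (abs_le.1 (hwb s hs' x)) k (abs_le.1 hk)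
    have he : F' (1, a) = (deriv f k - deriv f (w s x)) * F' (0, 1) := by
      rw [hsplit]; linarith
    have hgs : |g s| = |k - w s x| := by rw [abs_sub_comm]
    rw [he, abs_mul, hgs]
    calc _ ≤ (L * |k - w s x|) * C :=
          mul_le_mul hl hc (abs_nonneg _) ((abs_nonneg _).trans hl)
      _ = _ := by ring
  set K := L * C
  have key : ∀ σ : ℝ, ∀ s ∈ Ioo (0:ℝ) τ, ∃ g', |g'| ≤ K * |g s| ∧
      HasDerivAt (fun s => Real.exp (σ * s) * g s ^ 2)
        (Real.exp (σ * s) * (σ * g s ^ 2 + 2 * g s * g')) s := by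
    intro σ s hs
    obtain ⟨g', h1, h2⟩ := hgd s hs
    refine ⟨g', h2, ?_⟩
    have he : HasDerivAt (fun s => Real.exp (σ * s)) (Real.exp (σ * s) * σ) s := by
      simpa using ((hasDerivAt_id s).const_mul σ).exp
    refine (he.mul (h1.pow 2)).congr_deriv ?_
    simp only [Pi.pow_apply]
    push_cast
    ring
  have hcont : ∀ σ : ℝ, ContinuousOn (fun s => Real.exp (σ * s) * g s ^ 2) (Icc 0 τ) := by
    intro σ
    exact (Continuous.continuousOn (by fun_prop)).mul (hgc.pow 2)
  have hb : ∀ A B : ℝ, |B| ≤ K * |A| → |2 * A * B| ≤ 2 * K * A ^ 2 := by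
    intro A B h
    rw [abs_mul, abs_mul, abs_two, ← sq_abs A]
    nlinarith [abs_nonneg A, mul_le_mul_of_nonneg_left h (abs_nonneg A)]
  have hmono : MonotoneOn (fun s => Real.exp ((2 * K) * s) * g s ^ 2) (Icc 0 τ) := by
    apply monotoneOn_of_deriv_nonneg (convex_Icc 0 τ) (hcont _)
    · intro s hs
      rw [interior_Icc] at hs
      obtain ⟨g', _, h⟩ := key (2 * K) s hs
      exact h.differentiableAt.differentiableWithinAt
    · intro s hs
      rw [interior_Icc] at hs
      obtain ⟨g', h2, h⟩ := key (2 * K) s hs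
      rw [h.deriv]
      have := (abs_le.1 (hb _ _ h2)).1
      exact mul_nonneg (Real.exp_pos _).le (by linarith)
  have hanti : AntitoneOn (fun s => Real.exp ((-(2 * K)) * s) * g s ^ 2) (Icc 0 τ) := by
    apply antitoneOn_of_deriv_nonpos (convex_Icc 0 τ) (hcont _)
    · intro s hs
      rw [interior_Icc] at hs
      obtain ⟨g', _, h⟩ := key (-(2 * K)) s hs
      exact h.differentiableAt.differentiableWithinAt
    · intro s hs
      rw [interior_Icc] at hs
      obtain ⟨g', h2, h⟩ := key (-(2 * K)) s hs
      rw [h.deriv]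
      have := (abs_le.1 (hb _ _ h2)).2
      exact mul_nonpos_of_nonneg_of_nonpos (Real.exp_pos _).le (by linarith)
  have hg0 : g s₀ = 0 := sub_eq_zero.2 h0
  intro s hs
  have fin : ∀ e : ℝ, 0 < e → e * g s ^ 2 ≤ 0 → g s = 0 := by
    intro e he h
    have : g s ^ 2 ≤ 0 := by
      by_contra hn
      push Not at hn
      nlinarith [mul_pos he hn]
    exact pow_eq_zero_iff (two_ne_zero) |>.1 (le_antisymm this (sq_nonneg _))
  have : g s = 0 := by
    rcases le_total s s₀ with h | h
    · have := hmono hs hs₀ h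
      simp only [hg0] at this
      exact fin _ (Real.exp_pos (2 * K * s)) (by simpa using this)
    · have := hanti hs₀ hs h
      simp only [hg0] at this
      exact fin _ (Real.exp_pos (-(2 * K) * s)) (by simpa using this)
  exact sub_eq_zero.1 this

/-- Finite domain of dependence: classical solutions of the scalar conservation law
with wave speed between `0` and `β` depend on the initial data only within the
upwind interval of width `β·τ`. -/
theorem finite_domain_of_dependence
    (f : ℝ → ℝ) (hf : ContDiff ℝ 2 f) (τ β U : ℝ)
    (hτ : 0 < τ) (hβ : 0 ≤ β) (hU : 0 < U)
    (hspeed : ∀ s ∈ Icc (-U) U, 0 ≤ deriv f s ∧ deriv f s ≤ β)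
    (u v : ℝ → ℝ → ℝ)
    (hu : ContDiffOn ℝ 1 (fun p : ℝ × ℝ => u p.1 p.2) (Icc 0 τ ×ˢ univ))
    (hv : ContDiffOn ℝ 1 (fun p : ℝ × ℝ => v p.1 p.2) (Icc 0 τ ×ˢ univ))
    (hub : ∀ t ∈ Icc (0:ℝ) τ, ∀ x : ℝ, |u t x| ≤ U)
    (hvb : ∀ t ∈ Icc (0:ℝ) τ, ∀ x : ℝ, |v t x| ≤ U)
    (huxb : ∃ C : ℝ, ∀ t ∈ Icc (0:ℝ) τ, ∀ x : ℝ, |deriv (fun y => u t y) x| ≤ C)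
    (hvxb : ∃ C : ℝ, ∀ t ∈ Icc (0:ℝ) τ, ∀ x : ℝ, |deriv (fun y => v t y) x| ≤ C)
    (hupde : ∀ t ∈ Icc (0:ℝ) τ, ∀ x : ℝ,
      deriv (fun s => u s x) t + deriv f (u t x) * deriv (fun y => u t y) x = 0)
    (hvpde : ∀ t ∈ Icc (0:ℝ) τ, ∀ x : ℝ,
      deriv (fun s => v s x) t + deriv f (v t x) * deriv (fun y => v t y) x = 0)
    (c d : ℝ) (hcd : c ≤ d)
    (hinit : ∀ x ∈ Icc (c - β * τ) d, u 0 x = v 0 x) :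
    ∀ t ∈ Icc (0:ℝ) τ, ∀ x ∈ Icc c d, u t x = v t x := by
  intro t ht x hx
  set k := u t x with hk
  have hkU : |k| ≤ U := hub t ht x
  have h0 : (0:ℝ) ∈ Icc (0:ℝ) τ := ⟨le_rfl, hτ.le⟩
  have hx' : x - deriv f k * t + deriv f k * t = x := by ring
  have h1 := char_const f hf τ U u hu hub huxb hupde k (x - deriv f k * t) hkU t ht
    (by rw [hx']) 0 h0
  have hsp := hspeed k (abs_le.1 hkU)
  have hy : x - deriv f k * t + deriv f k * 0 ∈ Icc (c - β * τ) d := by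
    have e1 : deriv f k * t ≤ β * τ := mul_le_mul hsp.2 ht.2 ht.1 hβ
    have e2 : 0 ≤ deriv f k * t := mul_nonneg hsp.1 ht.1
    constructor <;> linarith [hx.1, hx.2]
  rw [hinit _ hy] at h1
  have h2 := char_const f hf τ U v hv hvb hvxb hvpde k (x - deriv f k * t) hkU 0 h0 h1 t ht
  rw [hx'] at h2
  exact h2.symm
end
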